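/- Let r > 0 and let x ∈ [0,1]^d satisfy ‖x‖₁ = Σ_{i=1}^d x_i < 1, and let η ∼ NegMultinomial(r, x). Then for all distinct j₁, j₂, j₃ ∈ {1,…,d}, E[η_{j₁}² η_{j₂} η_{j₃}] = y_{j₁} y_{j₂} y_{j₃}[(r+2)^{(3)} + (r+3)^{(4)} y_{j₁}], where m^{(k)} denotes the k-th order falling factorial of m. -/

import Mathlib

open scoped BigOperators

/-- The `k`-th order falling factorial `m^{(k)} = m(m-1)⋯(m-k+1)` of a real number `m`. -/
noncomputable def fallingFactorial (m : ℝ) (k : ℕ) : ℝ :=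
  ∏ i ∈ Finset.range k, (m - (i : ℝ))

/-- The probability mass function of the negative multinomial distribution
`NegMultinomial(r, x)` on `ℕ₀^d`. -/
noncomputable def negMultinomialPMF (d : ℕ) (r : ℝ) (x : Fin d → ℝ) (k : Fin d → ℕ) : ℝ :=
  Real.Gamma (r + ∑ i, (k i : ℝ)) / (Real.Gamma r * ∏ i, Real.Gamma ((k i : ℝ) + 1)) *
    (1 - ∑ i, x i) ^ r * ∏ i, (x i) ^ (k i)

theorem hasSum_prod_of_nonneg {α β : Type*} {f : α × β → ℝ} {g : α → ℝ} {s : ℝ}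
    (hf : 0 ≤ f) (hg : ∀ a, HasSum (fun b => f (a, b)) (g a)) (hs : HasSum g s) :
    HasSum f s := by
  have hsum : Summable f := (summable_prod_of_nonneg hf).2
    ⟨fun a => (hg a).summable, by simpa only [(hg _).tsum_eq] using hs.summable⟩
  have h := hsum.hasSum
  rwa [(h.prod_fiberwise hg).unique hs] at h

theorem Real.Gamma_add_natCast {r : ℝ} (hr : 0 < r) (n : ℕ) :
    Real.Gamma (r + n) = Real.Gamma r * (ascPochhammer ℝ n).eval r := by
  induction n with
  | zero => simp
  | succ n ih =>
    rw [Nat.cast_succ, ← add_assoc, Real.Gamma_add_one (by positivity), ih,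
      ascPochhammer_succ_eval]
    ring

theorem Real.hasSum_Gamma_mul_pow {r z : ℝ} (hr : 0 < r) (hz0 : 0 ≤ z) (hz1 : z < 1) :
    HasSum (fun n : ℕ => Real.Gamma (r + n) / Real.Gamma ((n : ℝ) + 1) * z ^ n)
      (Real.Gamma r * (1 - z) ^ (-r)) := by
  have h := (Real.one_div_one_sub_rpow_hasFPowerSeriesOnBall_zero r).hasSum (y := z)
    (by simpa [enorm_eq_nnnorm, ← NNReal.coe_lt_coe, abs_of_nonneg hz0] using hz1)
  rw [Real.rpow_neg (by linarith)]
  convert! h.mul_left (Real.Gamma r) using 1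
  · ext n
    have hc := Ring.factorial_nsmul_multichoose_eq_ascPochhammer r n
    rw [Polynomial.ascPochhammer_smeval_eq_eval, nsmul_eq_mul] at hc
    rw [Real.Gamma_add_natCast hr, Real.Gamma_nat_eq_factorial, ← hc, Ring.multichoose_eq]
    have : (n.factorial : ℝ) ≠ 0 := by positivity
    simp
    field_simp
  · simp

theorem hasSum_Gamma_mul_prod_pow (d : ℕ) : ∀ (r : ℝ) (_ : 0 < r) (x : Fin d → ℝ)
    (_ : ∀ i, 0 ≤ x i) (_ : ∑ i, x i < 1),
    HasSum (fun k : Fin d → ℕ => Real.Gamma (r + ∑ i, (k i : ℝ)) /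
      (∏ i, Real.Gamma ((k i : ℝ) + 1)) * ∏ i, x i ^ k i)
      (Real.Gamma r * (1 - ∑ i, x i) ^ (-r)) := by
  induction d with
  | zero =>
    intro r hr x hx hx1
    simp
  | succ d ih =>
    intro r hr x hx hx1
    rw [Fin.sum_univ_succ] at hx1
    have h0 := hx 0
    have hs : 0 ≤ ∑ i : Fin d, x i.succ := Finset.sum_nonneg fun i _ => hx _
    have hpos : 0 < 1 - ∑ i : Fin d, x i.succ := by linarith
    rw [← (Fin.consEquiv fun _ : Fin (d + 1) => ℕ).hasSum_iff]
    refine hasSum_prod_of_nonneg (α := ℕ) (β := Fin d → ℕ) (g := fun n => Real.Gamma (r + n) / Real.Gamma ((n : ℝ) + 1) *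
      (x 0 / (1 - ∑ i : Fin d, x i.succ)) ^ n * (1 - ∑ i : Fin d, x i.succ) ^ (-r)) ?_ ?_ ?_
    · intro p
      refine mul_nonneg (div_nonneg ?_ (Finset.prod_nonneg fun i _ => ?_))
        (Finset.prod_nonneg fun i _ => pow_nonneg (hx i) _)
      · exact Real.Gamma_nonneg_of_nonneg (by positivity)
      · exact Real.Gamma_nonneg_of_nonneg (by positivity)
    · intro n
      have h := (ih (r + n) (by positivity) (fun i => x i.succ) (fun i => hx _)
        (by linarith)).mul_left (x 0 ^ n / Real.Gamma ((n : ℝ) + 1))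
      convert! h using 1
      · ext k
        simp only [Function.comp, Fin.consEquiv_apply, Fin.sum_univ_succ, Fin.prod_univ_succ,
          Fin.cons_zero, Fin.cons_succ, add_assoc]
        field_simp
      · rw [neg_add, Real.rpow_add hpos, Real.rpow_neg hpos.le (n : ℝ), Real.rpow_natCast, div_pow]
        field_simp
    · have h := (Real.hasSum_Gamma_mul_pow hr (div_nonneg h0 hpos.le)
        ((div_lt_one hpos).2 (by linarith))).mul_right ((1 - ∑ i : Fin d, x i.succ) ^ (-r))
      convert! h using 1
      rw [mul_assoc, ← Real.mul_rpow _ hpos.le, Fin.sum_univ_succ]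
      · congr 2
        field_simp
        ring
      · rw [sub_nonneg, div_le_one hpos]
        linarith

theorem hasSum_negMultinomialPMF {d : ℕ} {r : ℝ} (hr : 0 < r) {x : Fin d → ℝ}
    (hx : ∀ i, 0 ≤ x i) (hx1 : ∑ i, x i < 1) : HasSum (negMultinomialPMF d r x) 1 := by
  have hpos : 0 < 1 - ∑ i, x i := by linarith
  have hG := (Real.Gamma_pos_of_pos hr).ne'
  convert! (hasSum_Gamma_mul_prod_pow d r hr x hx hx1).mul_left
    ((1 - ∑ i, x i) ^ r / Real.Gamma r) using 1
  · ext k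
    rw [negMultinomialPMF]
    field_simp
  · have := (Real.rpow_pos_of_pos hpos r).ne'
    rw [Real.rpow_neg hpos.le]
    field_simp

theorem negMultinomialPMF_add_single {d : ℕ} {r : ℝ} (hr : 0 < r) {x : Fin d → ℝ}
    (hx1 : ∑ i, x i < 1) (j : Fin d) (k : Fin d → ℕ) :
    negMultinomialPMF d r x (k + Pi.single j 1) * ((k j : ℝ) + 1) =
      r * (x j / (1 - ∑ i, x i)) * negMultinomialPMF d (r + 1) x k := by
  have hpos : 0 < 1 - ∑ i, x i := by linarith
  have hG := (Real.Gamma_pos_of_pos hr).ne'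
  have hsum : ∑ i, ((k + Pi.single j 1 : Fin d → ℕ) i : ℝ) = ∑ i, (k i : ℝ) + 1 := by
    simp [Finset.sum_add_distrib, Pi.single_apply]
  have hpow : ∏ i, x i ^ (k + Pi.single j 1 : Fin d → ℕ) i = (∏ i, x i ^ k i) * x j := by
    simp only [Pi.add_apply, pow_add, Finset.prod_mul_distrib, Pi.single_apply, pow_ite, pow_one,
      pow_zero, Finset.prod_ite_eq', Finset.mem_univ, if_true]
  have hGamma : ∏ i, Real.Gamma (((k + Pi.single j 1 : Fin d → ℕ) i : ℝ) + 1) =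
      (∏ i, Real.Gamma ((k i : ℝ) + 1)) * ((k j : ℝ) + 1) := by
    have (i : Fin d) : Real.Gamma (((k + Pi.single j 1 : Fin d → ℕ) i : ℝ) + 1) =
        Real.Gamma ((k i : ℝ) + 1) * if i = j then (k j : ℝ) + 1 else 1 := by
      rcases eq_or_ne i j with rfl | h
      · simp only [Pi.add_apply, Pi.single_eq_same, Nat.cast_add, Nat.cast_one, if_true]
        rw [Real.Gamma_add_one (by positivity), mul_comm]
      · simp [h]
    simp only [this, Finset.prod_mul_distrib, Finset.prod_ite_eq', Finset.mem_univ, if_true]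
  have hne : ∏ i, Real.Gamma ((k i : ℝ) + 1) ≠ 0 :=
    Finset.prod_ne_zero_iff.2 fun i _ => (Real.Gamma_pos_of_pos (by positivity)).ne'
  have hk : (k j : ℝ) + 1 ≠ 0 := by positivity
  rw [negMultinomialPMF, negMultinomialPMF, hsum, hpow, hGamma, Real.Gamma_add_one hr.ne',
    Real.rpow_add_one hpos.ne', add_right_comm r 1, add_assoc r]
  field_simp

/-- Size-biasing: weighting `NegMultinomial(r, x)` by its `j`-th coordinate gives a multiple of
`NegMultinomial(r + 1, x)` shifted by one in that coordinate. -/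
theorem hasSum_negMultinomialPMF_mul_coord {d : ℕ} {r : ℝ} (hr : 0 < r) {x : Fin d → ℝ}
    (hx1 : ∑ i, x i < 1) (j : Fin d) {g : (Fin d → ℕ) → ℝ} {s : ℝ}
    (hg : HasSum (fun k => negMultinomialPMF d (r + 1) x k * g (k + Pi.single j 1)) s) :
    HasSum (fun k => negMultinomialPMF d r x k * ((k j : ℝ) * g k))
      (r * (x j / (1 - ∑ i, x i)) * s) := by
  have hinj : Function.Injective fun k : Fin d → ℕ => k + Pi.single j 1 :=
    add_left_injective _
  rw [← hinj.hasSum_iff]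
  · convert! hg.mul_left (r * (x j / (1 - ∑ i, x i))) using 1
    ext k
    rw [← mul_assoc, ← negMultinomialPMF_add_single hr hx1]
    simp [mul_assoc]
  · intro k hk
    have : k j = 0 := by
      by_contra h
      refine hk ⟨k - Pi.single j 1, tsub_add_cancel_of_le fun i => ?_⟩
      rcases eq_or_ne i j with rfl | h'
      · simpa using Nat.one_le_iff_ne_zero.2 h
      · simp [h']
    simp [this]

theorem negMultinomial_moment211 (d : ℕ) (r : ℝ) (hr : 0 < r) (x : Fin d → ℝ)
    (hx : ∀ i, x i ∈ Set.Icc (0 : ℝ) 1) (hx1 : ∑ i, x i < 1)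
    (y : Fin d → ℝ) (hy : ∀ i, y i = x i / (1 - ∑ j, x j))
    (j₁ j₂ j₃ : Fin d) (h12 : j₁ ≠ j₂) (h13 : j₁ ≠ j₃) (h23 : j₂ ≠ j₃) :
    (∑' η : Fin d → ℕ, negMultinomialPMF d r x η * ((η j₁ : ℝ) ^ 2 * (η j₂ : ℝ) * (η j₃ : ℝ)))
      = y j₁ * y j₂ * y j₃ * (fallingFactorial (r + 2) 3 + fallingFactorial (r + 3) 4 * y j₁) := by
  have hx0 : ∀ i, 0 ≤ x i := fun i => (hx i).1
  have pair {s : ℝ} (hs : 0 < s) : HasSum (fun k => negMultinomialPMF d s x k *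
      ((k j₂ : ℝ) * (k j₃ : ℝ))) (s * y j₂ * ((s + 1) * y j₃)) := by
    rw [hy, hy]
    refine hasSum_negMultinomialPMF_mul_coord hs hx1 j₂ (g := fun k => (k j₃ : ℝ)) ?_
    have h := hasSum_negMultinomialPMF_mul_coord (add_pos hs one_pos) hx1 j₃ (g := fun _ => 1)
      (by simpa using hasSum_negMultinomialPMF (by positivity : 0 < s + 1 + 1) hx0 hx1)
    simpa [h23.symm] using h
  have triple {s : ℝ} (hs : 0 < s) : HasSum (fun k => negMultinomialPMF d s x k *
      ((k j₁ : ℝ) * ((k j₂ : ℝ) * (k j₃ : ℝ))))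
      (s * y j₁ * ((s + 1) * y j₂ * ((s + 1 + 1) * y j₃))) := by
    rw [hy j₁]
    refine hasSum_negMultinomialPMF_mul_coord hs hx1 j₁
      (g := fun k => (k j₂ : ℝ) * (k j₃ : ℝ)) ?_
    simpa [h12.symm, h13.symm] using pair (add_pos hs one_pos)
  have hr1 : 0 < r + 1 := add_pos hr one_pos
  have key := hasSum_negMultinomialPMF_mul_coord hr hx1 j₁
    (g := fun k => (k j₁ : ℝ) * ((k j₂ : ℝ) * (k j₃ : ℝ)))
    (s := (r + 1) * y j₁ * ((r + 1 + 1) * y j₂ * ((r + 1 + 1 + 1) * y j₃)) +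
      (r + 1) * y j₂ * ((r + 1 + 1) * y j₃)) (by
      convert! (triple hr1).add (pair hr1) using 1
      ext k
      simp [h12.symm, h13.symm]
      ring)
  rw [← hy] at key
  convert key.tsum_eq using 1
  · congr 1
    ext k
    ring
  · simp only [fallingFactorial, Finset.prod_range_succ, Finset.prod_range_zero]
    push_cast
    ring
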